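/- Let a_1,…,a_r ∈ I form a regular sequence in Q and set R = Q/(a_1,…,a_r). Suppose s := scarf(I) < ∞. Then R/I admits a free resolution G over R with rank G_m = Σ_{j=0}^{⌊m/2⌋} (binom(q, m−2j) − binom(q−s, m−2j−s)) · binom(r+j−1, r−1) for every m ≥ 0; consequently, if F is any minimal free resolution of R/I over R, then rank F_{2i} ≤ Σ_{j=0}^{i} (binom(q,2j) − binom(q−s,2j−s)) · binom(r+i−j−1, r−1) and rank F_{2i+1} ≤ Σ_{j=0}^{i} (binom(q,2j+1) − binom(q−s,2j+1−s)) · binom(r+i−j−1, r−1) for every i ≥ 0. -/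

import Mathlib

open MvPolynomial Finset

noncomputable section

/-- `fsign A B` is `0` if `A ∩ B ≠ ∅`, and otherwise `(−1)^{p(A,B)}` where `p(A,B)`
is the number of pairs `(a,b) ∈ A × B` with `a > b`. -/
def fsign {α : Type*} [LinearOrder α] [DecidableEq α] (A B : Finset α) : ℤ :=
  if A ∩ B = ∅ then (-1 : ℤ) ^ (((A ×ˢ B).filter fun p => p.2 < p.1).card) else 0

/-- The total module underlying the Taylor complex: free over `Q = k[x_1,…,x_n]`
with basis `ε_τ` indexed by all subsets `τ ⊆ [q]`. -/
abbrev TotMod (k : Type*) [Field k] (n q : ℕ) : Type _ :=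
  Finset (Fin q) →₀ MvPolynomial (Fin n) k

/-- `m_τ = lcm{m_i : i ∈ τ}`, where `m_i` is the monomial with exponent vector `D i`. -/
def lcmMono (k : Type*) [Field k] (n q : ℕ) (D : Fin q → (Fin n →₀ ℕ))
    (τ : Finset (Fin q)) : MvPolynomial (Fin n) k :=
  monomial (τ.sup D) (1 : k)

/-- The monomial ideal `I = (m_1, …, m_q)`. -/
def monIdeal (k : Type*) [Field k] (n q : ℕ) (D : Fin q → (Fin n →₀ ℕ)) :
    Ideal (MvPolynomial (Fin n) k) :=
  Ideal.span (Set.range fun i => monomial (D i) (1 : k))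

/-- The Taylor differential `∂(ε_τ) = Σ_{j∈τ} sign(j, τ∖{j}) (m_τ/m_{τ∖{j}}) ε_{τ∖{j}}`,
as a linear endomorphism of the total module. -/
def taylorD (k : Type*) [Field k] (n q : ℕ) (D : Fin q → (Fin n →₀ ℕ)) :
    TotMod k n q →ₗ[MvPolynomial (Fin n) k] TotMod k n q :=
  Finsupp.linearCombination _ fun τ =>
    ∑ j ∈ τ, Finsupp.single (τ \ {j})
      ((fsign {j} (τ \ {j}) : MvPolynomial (Fin n) k) *
        monomial (τ.sup D - (τ \ {j}).sup D) (1 : k))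

/-- The degree-`i` piece of the subcomplex of the Taylor complex spanned by the
`ε_τ` with `τ ∈ Ω`: the free submodule with basis `{ε_τ : τ ∈ Ω, |τ| = i}`. -/
def piece (k : Type*) [Field k] (n q : ℕ) (Ω : Set (Finset (Fin q))) (i : ℕ) :
    Submodule (MvPolynomial (Fin n) k) (TotMod k n q) :=
  Finsupp.supported _ _ {τ | τ ∈ Ω ∧ τ.card = i}

/-- The subcomplex of the Taylor complex spanned by all `ε_τ` with `τ ∈ Ω`. -/
def subcx (k : Type*) [Field k] (n q : ℕ) (Ω : Set (Finset (Fin q))) :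
    Submodule (MvPolynomial (Fin n) k) (TotMod k n q) :=
  Finsupp.supported _ _ Ω

/-- The index family of the pivot complex `T_S`: all `τ` with `τ ⊉ S`. -/
def pivotΩ {q : ℕ} (S : Finset (Fin q)) : Set (Finset (Fin q)) := {τ | ¬ S ⊆ τ}

/-- The subcomplex of the Taylor complex spanned by `{ε_τ : τ ∈ Ω}` is a resolution
of `Q/I`: it is exact in homological degrees `≥ 1`, and its zeroth homology is
identified with `Q/I` via the augmentation `ε_∅ ↦ 1`. -/
def IsResolutionOf (k : Type*) [Field k] (n q : ℕ) (D : Fin q → (Fin n →₀ ℕ))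
    (Ω : Set (Finset (Fin q))) : Prop :=
  (∀ i : ℕ, ∀ x ∈ piece k n q Ω (i + 1), taylorD k n q D x = 0 →
      ∃ y ∈ piece k n q Ω (i + 2), taylorD k n q D y = x) ∧
  (∀ x ∈ piece k n q Ω 0,
      (x (∅ : Finset (Fin q)) ∈ monIdeal k n q D ↔
        ∃ y ∈ piece k n q Ω 1, taylorD k n q D y = x))

/-- The Scarf set of `I`: all `t` such that there are two distinct subsets
`τ ≠ τ'` of `[q]` with `|τ| = t` and `m_τ = m_{τ'}`.  The Scarf number of `I`
is `sInf` of this set; `scarf(I) = ∞` corresponds to this set being empty. -/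
def scarfSet (k : Type*) [Field k] (n q : ℕ) (D : Fin q → (Fin n →₀ ℕ)) : Set ℕ :=
  {t | ∃ τ τ' : Finset (Fin q), τ ≠ τ' ∧ τ.card = t ∧
        lcmMono k n q D τ = lcmMono k n q D τ'}

end

/-- A free resolution of a module `M` over a ring `R`: free modules `F_i` of rank
`rk i`, differentials `d i : F_{i+1} → F_i`, and an augmentation `F_0 ↠ M` with
`ker(aug) = im(d 0)` and exactness everywhere else. -/
structure FreeResolution (R : Type*) [CommRing R]
    (M : Type*) [AddCommGroup M] [Module R M] where
  rk : ℕ → ℕ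
  d : ∀ i : ℕ, (Fin (rk (i + 1)) →₀ R) →ₗ[R] (Fin (rk i) →₀ R)
  aug : (Fin (rk 0) →₀ R) →ₗ[R] M
  aug_surjective : Function.Surjective aug
  exact_zero : LinearMap.range (d 0) = LinearMap.ker aug
  exact_succ : ∀ i : ℕ, LinearMap.range (d (i + 1)) = LinearMap.ker (d i)

/-- A minimal free resolution: a free resolution with `∂(F_{i+1}) ⊆ mR·F_i` for the
distinguished (irrelevant maximal) ideal `mR`. -/
structure MinimalFreeResolution (R : Type*) [CommRing R] (mR : Ideal R)
    (M : Type*) [AddCommGroup M] [Module R M] extends FreeResolution R M where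
  minimal : ∀ i : ℕ,
    LinearMap.range (d i) ≤ mR • (⊤ : Submodule R (Fin (rk i) →₀ R))

namespace ES

theorem lift_free {R : Type*} [CommRing R] {ι N N' : Type*} [AddCommGroup N] [Module R N]
    [AddCommGroup N'] [Module R N'] (f : (ι →₀ R) →ₗ[R] N) (g : N' →ₗ[R] N)
    (h : ∀ x, f x ∈ LinearMap.range g) : ∃ ψ : (ι →₀ R) →ₗ[R] N', ∀ x, g (ψ x) = f x := by
  choose u hu using fun i => h (Finsupp.single i 1)
  refine ⟨Finsupp.linearCombination R u, fun x => ?_⟩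
  have : g ∘ₗ Finsupp.linearCombination R u = f := by
    ext i
    simp [hu]
  exact LinearMap.congr_fun this x

theorem exists_seq {X : ℕ → Type*} (good : ∀ m, X m → Prop) (rel : ∀ m, X m → X (m + 1) → Prop)
    (x0 : X 0) (h0 : good 0 x0)
    (hs : ∀ m (x : X m), good m x → ∃ y : X (m + 1), rel m x y ∧ good (m + 1) y) :
    ∃ s : ∀ m, X m, s 0 = x0 ∧ (∀ m, rel m (s m) (s (m + 1))) ∧ ∀ m, good m (s m) := by
  choose nx hnx using hs
  let s : ∀ m, {x : X m // good m x} := fun m =>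
    Nat.rec ⟨x0, h0⟩ (fun m x => ⟨nx m x.1 x.2, (hnx m x.1 x.2).2⟩) m
  exact ⟨fun m => (s m).1, rfl, fun m => (hnx m (s m).1 (s m).2).1, fun m => (s m).2⟩

section res
variable {R : Type*} [CommRing R] {M : Type*} [AddCommGroup M] [Module R M]
  {M' : Type*} [AddCommGroup M'] [Module R M']

theorem d0_mem (F : FreeResolution R M) (x) : F.aug x = 0 ↔ ∃ y, F.d 0 y = x := by
  rw [← LinearMap.mem_ker, ← F.exact_zero, LinearMap.mem_range]

theorem ds_mem (F : FreeResolution R M) (i : ℕ) (x) : F.d i x = 0 ↔ ∃ y, F.d (i + 1) y = x := by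
  rw [← LinearMap.mem_ker, ← F.exact_succ, LinearMap.mem_range]

theorem aug_d (F : FreeResolution R M) (x) : F.aug (F.d 0 x) = 0 := (d0_mem F _).2 ⟨x, rfl⟩
theorem dd (F : FreeResolution R M) (i : ℕ) (x) : F.d i (F.d (i + 1) x) = 0 :=
  (ds_mem F i _).2 ⟨x, rfl⟩

theorem chain_lift (F : FreeResolution R M) (G : FreeResolution R M') (f : M →ₗ[R] M') :
    ∃ φ : ∀ m, (Fin (F.rk m) →₀ R) →ₗ[R] (Fin (G.rk m) →₀ R),
      (∀ x, G.aug (φ 0 x) = f (F.aug x)) ∧ ∀ m x, G.d m (φ (m + 1) x) = φ m (F.d m x) := by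
  obtain ⟨φ0, h0⟩ := lift_free (f ∘ₗ F.aug) G.aug (fun x => G.aug_surjective _)
  obtain ⟨s, hs0, hs, -⟩ := exists_seq
    (X := fun m => (Fin (F.rk m) →₀ R) →ₗ[R] (Fin (G.rk m) →₀ R))
    (fun m φ => ∀ x, φ (F.d m x) ∈ LinearMap.range (G.d m))
    (fun m φ ψ => ∀ x, G.d m (ψ x) = φ (F.d m x)) φ0
    (by
      intro x
      rw [LinearMap.mem_range, ← d0_mem, h0]
      simp [aug_d])
    (by
      intro m φ hφ
      obtain ⟨ψ, hψ⟩ := lift_free (φ ∘ₗ F.d m) (G.d m) hφ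
      refine ⟨ψ, hψ, fun x => ?_⟩
      rw [LinearMap.mem_range, ← ds_mem, hψ]
      simp [dd])
  exact ⟨s, by rw [hs0]; exact h0, hs⟩

theorem null_homotopy (F : FreeResolution R M)
    (γ : ∀ m, (Fin (F.rk m) →₀ R) →ₗ[R] (Fin (F.rk m) →₀ R))
    (h0 : ∀ x, F.aug (γ 0 x) = 0) (hγ : ∀ m x, F.d m (γ (m + 1) x) = γ m (F.d m x)) :
    ∃ h : ∀ m, (Fin (F.rk m) →₀ R) →ₗ[R] (Fin (F.rk (m + 1)) →₀ R),
      (∀ x, F.d 0 (h 0 x) = γ 0 x) ∧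
      ∀ m x, F.d (m + 1) (h (m + 1) x) = γ (m + 1) x - h m (F.d m x) := by
  obtain ⟨k0, hk0⟩ := lift_free (γ 0) (F.d 0) (fun x => by
    rw [LinearMap.mem_range, ← d0_mem, h0])
  obtain ⟨s, hs0, hs, -⟩ := exists_seq
    (X := fun m => (Fin (F.rk m) →₀ R) →ₗ[R] (Fin (F.rk (m + 1)) →₀ R))
    (fun m h => ∀ x, γ (m + 1) x - h (F.d m x) ∈ LinearMap.range (F.d (m + 1)))
    (fun m h h' => ∀ x, F.d (m + 1) (h' x) = γ (m + 1) x - h (F.d m x)) k0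
    (by
      intro x
      rw [LinearMap.mem_range, ← ds_mem, map_sub, hγ, hk0, sub_self])
    (by
      intro m φ hφ
      obtain ⟨ψ, hψ⟩ := lift_free (γ (m + 1) - φ ∘ₗ F.d m) (F.d (m + 1)) hφ
      refine ⟨ψ, hψ, fun x => ?_⟩
      rw [LinearMap.mem_range, ← ds_mem, map_sub, hγ, hψ]
      simp [dd])
  exact ⟨s, by rw [hs0]; exact hk0, hs⟩

theorem minimal_le {k : Type*} [CommRing k] [Nontrivial k] (ε : R →+* k) (mR : Ideal R)
    (hε : ∀ x ∈ mR, ε x = 0)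
    (F : MinimalFreeResolution R mR M) (G : FreeResolution R M) (m : ℕ) : F.rk m ≤ G.rk m := by
  obtain ⟨α, ha0, ha⟩ := chain_lift F.toFreeResolution G LinearMap.id
  obtain ⟨β, hb0, hb⟩ := chain_lift G F.toFreeResolution LinearMap.id
  obtain ⟨h, hh0, hh⟩ := null_homotopy F.toFreeResolution
    (fun m => β m ∘ₗ α m - LinearMap.id) (by intro x; simp [hb0, ha0])
    (by intro m x; simp [hb, ha])
  have key : ∀ x, β m (α m x) - x ∈ mR • (⊤ : Submodule R (Fin (F.rk m) →₀ R)) := by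
    intro x
    cases m with
    | zero =>
      have := F.minimal 0 ⟨_, hh0 x⟩
      simpa using this
    | succ m =>
      have h1 := F.minimal (m + 1) ⟨_, hh m x⟩
      have h2 : h m (F.d m x) ∈ mR • (⊤ : Submodule R (Fin (F.rk (m + 1)) →₀ R)) := by
        have h3 : F.d m x ∈ mR • (⊤ : Submodule R (Fin (F.rk m) →₀ R)) := F.minimal m ⟨_, rfl⟩
        have h4 := Submodule.mem_map_of_mem (f := h m) h3
        rw [Submodule.map_smul''] at h4
        exact Submodule.smul_mono le_rfl le_top h4
      have := add_mem h1 h2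
      simpa using this
  have key2 : ∀ x, ∀ i, ε ((β m (α m x) - x) i) = 0 := by
    intro x i
    apply hε
    refine Submodule.smul_induction_on (p := fun y => y i ∈ mR) (key x) ?_ ?_
    · intro r hr y _
      simpa using Ideal.mul_mem_right _ _ hr
    · intro y z hy hz
      simpa using add_mem hy hz
  let A : Matrix (Fin (G.rk m)) (Fin (F.rk m)) k := fun j i => ε (α m (Finsupp.single i 1) j)
  let B : Matrix (Fin (F.rk m)) (Fin (G.rk m)) k := fun j i => ε (β m (Finsupp.single i 1) j)
  have hBA : B * A = 1 := by
    ext i j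
    have h1 := key2 (Finsupp.single j 1) i
    have h2 : β m (α m (Finsupp.single j 1)) i =
        ∑ l, α m (Finsupp.single j 1) l * β m (Finsupp.single l 1) i := by
      conv_lhs => rw [← Finsupp.univ_sum_single (α m (Finsupp.single j 1))]
      rw [map_sum, Finsupp.finsetSum_apply]
      refine Finset.sum_congr rfl fun l _ => ?_
      rw [show Finsupp.single l ((α m) (Finsupp.single j 1) l) =
        (α m) (Finsupp.single j 1) l • Finsupp.single l (1 : R) by simp, map_smul]
      simp
    rw [Finsupp.sub_apply, h2, map_sub, sub_eq_zero, map_sum] at h1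
    simp only [map_mul] at h1
    rw [Matrix.mul_apply, Matrix.one_apply]
    have h3 : ∑ l, B i l * A l j = ε ((Finsupp.single j (1 : R)) i) := by
      rw [← h1]
      exact Finset.sum_congr rfl (fun l _ => mul_comm _ _)
    rw [h3, Finsupp.single_apply]
    by_cases hij : i = j
    · rw [if_pos hij, if_pos hij.symm, map_one]
    · rw [if_neg hij, if_neg (Ne.symm hij), map_zero]
  have hinj : Function.Injective (Matrix.mulVecLin A) := by
    intro x y hxy
    have := congrArg (Matrix.mulVec B) hxy
    simpa [Matrix.mulVec_mulVec, hBA] using this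
  simpa using card_le_of_injective k _ hinj

/-- splitting -/
theorem spl (R : Type*) [CommRing R] (a b c : ℕ) (h : c = a + b) :
    Nonempty ((Fin c →₀ R) ≃ₗ[R] (Fin a →₀ R) × (Fin b →₀ R)) := by
  subst h
  exact ⟨(Finsupp.domLCongr finSumFinEquiv.symm).trans (Finsupp.sumFinsuppLEquivProdFinsupp R)⟩

theorem spl0 (R : Type*) [CommRing R] (a c : ℕ) (h : c = a) :
    Nonempty ((Fin c →₀ R) ≃ₗ[R] (Fin a →₀ R)) := by
  subst h
  exact ⟨LinearEquiv.refl _ _⟩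

theorem cone {M'' : Type*} [AddCommGroup M''] [Module R M'']
    (A : FreeResolution R M) (B : FreeResolution R M') (f : M →ₗ[R] M') (g : M' →ₗ[R] M'')
    (hf : Function.Injective f) (hg : Function.Surjective g)
    (hfg : ∀ x, g x = 0 ↔ ∃ y, f y = x) (c : ℕ → ℕ) (hc0 : c 0 = B.rk 0)
    (hcs : ∀ m, c (m + 1) = B.rk (m + 1) + A.rk m) :
    ∃ C : FreeResolution R M'', C.rk = c := by
  obtain ⟨φ, h0, hφ⟩ := chain_lift A B f
  obtain ⟨e0⟩ := spl0 R _ _ hc0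
  have es := fun m => (spl R _ _ _ (hcs m)).some
  obtain ⟨d, hd0, hds⟩ : ∃ d : ∀ m, (Fin (c (m + 1)) →₀ R) →ₗ[R] (Fin (c m) →₀ R),
      (∀ x y, d 0 ((es 0).symm (x, y)) = e0.symm (B.d 0 x + φ 0 y)) ∧
      (∀ m x y, d (m + 1) ((es (m + 1)).symm (x, y)) =
        (es m).symm (B.d (m + 1) x + φ (m + 1) y, -(A.d m y))) := by
    refine ⟨fun m => match m with
      | 0 => e0.symm.toLinearMap ∘ₗ (LinearMap.coprod (B.d 0) (φ 0)) ∘ₗ (es 0).toLinearMap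
      | m + 1 => (es m).symm.toLinearMap ∘ₗ
        (LinearMap.prod (LinearMap.coprod (B.d (m + 1)) (φ (m + 1)))
          (-(A.d m ∘ₗ LinearMap.snd R _ _))) ∘ₗ (es (m + 1)).toLinearMap, ?_, ?_⟩
    · intro x y; simp
    · intro m x y; simp
  refine ⟨⟨c, d, g ∘ₗ B.aug ∘ₗ e0.toLinearMap,
    hg.comp (B.aug_surjective.comp e0.surjective), ?_, ?_⟩, rfl⟩
  · ext z
    simp only [LinearMap.mem_range, LinearMap.mem_ker, LinearMap.comp_apply,
      LinearEquiv.coe_coe]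
    constructor
    · rintro ⟨w, rfl⟩
      obtain ⟨⟨x, y⟩, rfl⟩ := (es 0).symm.surjective w
      rw [hd0, LinearEquiv.apply_symm_apply, map_add, aug_d, zero_add, h0, hfg]
      exact ⟨_, rfl⟩
    · intro hz
      obtain ⟨y, hy⟩ := (hfg _).1 hz
      obtain ⟨y, rfl⟩ := A.aug_surjective y
      rw [← h0, ← sub_eq_zero, ← map_sub, d0_mem] at hy
      obtain ⟨x, hx⟩ := hy
      refine ⟨(es 0).symm (-x, y), ?_⟩
      rw [hd0, LinearEquiv.symm_apply_eq, map_neg, hx]; abel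
  · intro i
    ext z
    simp only [LinearMap.mem_range, LinearMap.mem_ker]
    cases i with
    | zero =>
      obtain ⟨⟨x, y⟩, rfl⟩ := (es 0).symm.surjective z
      rw [hd0, LinearEquiv.map_eq_zero_iff]
      constructor
      · rintro ⟨w, hw⟩
        obtain ⟨⟨x', y'⟩, rfl⟩ := (es 1).symm.surjective w
        rw [hds] at hw
        have := (es 0).symm.injective hw
        simp only [Prod.mk.injEq] at this
        obtain ⟨rfl, rfl⟩ := this
        simp [dd, hφ]
      · intro h
        have hy : A.aug y = 0 := by
          apply hf
          rw [map_zero, ← h0]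
          have := congrArg B.aug h
          simpa [aug_d] using this
        obtain ⟨y', rfl⟩ := (d0_mem _ _).1 hy
        rw [← hφ, ← map_add, ds_mem] at h
        obtain ⟨x', hx'⟩ := h
        refine ⟨(es 1).symm (x', -y'), ?_⟩
        rw [hds, hx']
        congr 1
        simp
    | succ i =>
      obtain ⟨⟨x, y⟩, rfl⟩ := (es (i + 1)).symm.surjective z
      rw [hds]
      rw [LinearEquiv.map_eq_zero_iff, Prod.mk_eq_zero]
      constructor
      · rintro ⟨w, hw⟩
        obtain ⟨⟨x', y'⟩, rfl⟩ := (es (i + 2)).symm.surjective w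
        rw [hds] at hw
        have := (es (i + 1)).symm.injective hw
        simp only [Prod.mk.injEq] at this
        obtain ⟨rfl, rfl⟩ := this
        simp [dd, hφ]
      · rintro ⟨h, hy⟩
        obtain ⟨y', rfl⟩ := (ds_mem _ _ _).1 (neg_eq_zero.1 hy)
        rw [← hφ, ← map_add, ds_mem] at h
        obtain ⟨x', hx'⟩ := h
        refine ⟨(es (i + 2)).symm (x', -y'), ?_⟩
        rw [hds, hx']
        congr 1
        simp

end res

def sh (f : ℕ → ℕ) : ℕ → ℕ
  | 0 => f 0
  | 1 => f 1
  | m + 2 => f (m + 2) + sh f m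

theorem splice {R : Type*} [CommRing R] {M : Type*} [AddCommGroup M] [Module R M]
    (c : ℕ → ℕ) (D : ∀ m, (Fin (c (m + 1)) →₀ R) →ₗ[R] (Fin (c m) →₀ R))
    (aug : (Fin (c 0) →₀ R) →ₗ[R] M) (haug : Function.Surjective aug)
    (h0 : ∀ x, aug x = 0 ↔ ∃ y, D 0 y = x)
    (hex : ∀ m x, D (m + 1) x = 0 ↔ ∃ y, D (m + 2) y = x)
    (hDD : ∀ x, D 0 (D 1 x) = 0)
    (φ : (Fin (c 0) →₀ R) →ₗ[R] (Fin (c 1) →₀ R)) (hφ : ∀ y, D 0 (φ y) = 0)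
    (h1 : ∀ y, aug y = 0 ↔ ∃ z, D 1 z = φ y)
    (h2 : ∀ x, D 0 x = 0 → ∃ y z, D 1 z + φ y = x)
    (g : ℕ → ℕ) (hg0 : g 0 = c 0) (hg1 : g 1 = c 1) (hgs : ∀ m, g (m + 2) = c (m + 2) + g m) :
    ∃ G : FreeResolution R M, G.rk = g := by
  obtain ⟨e0⟩ := spl0 R _ _ hg0
  obtain ⟨e1⟩ := spl0 R _ _ hg1
  have es := fun m => (spl R _ _ _ (hgs m)).some
  -- state: (d_m, d_{m+1}, φ_m)
  let X : ℕ → Type _ := fun m => ((Fin (g (m + 1)) →₀ R) →ₗ[R] (Fin (g m) →₀ R)) ×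
    ((Fin (g (m + 2)) →₀ R) →ₗ[R] (Fin (g (m + 1)) →₀ R)) ×
    ((Fin (g m) →₀ R) →ₗ[R] (Fin (c (m + 1)) →₀ R))
  obtain ⟨s, hs0, hsr, hsg⟩ := exists_seq (X := X)
    (fun m x => (∀ z, ∃ y, D (m + 1) y = x.2.2 (x.1 z)) ∧ (∀ z, x.1 (x.2.1 z) = 0) ∧
      ∀ u v, D (m + 1) u + x.2.2 (x.1 v) = 0 → x.2.1 ((es m).symm (u, x.1 v)) = 0)
    (fun m x y => y.1 = x.2.1 ∧ (∀ z, D (m + 1) (y.2.2 z) = - x.2.2 (x.1 z)) ∧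
      ∀ u v, y.2.1 ((es (m + 1)).symm (u, v)) = (es m).symm (D (m + 2) u + y.2.2 v, x.1 v))
    (e0.symm.toLinearMap ∘ₗ D 0 ∘ₗ e1.toLinearMap,
      e1.symm.toLinearMap ∘ₗ (LinearMap.coprod (D 1) (φ ∘ₗ e0.toLinearMap)) ∘ₗ
        (es 0).toLinearMap, φ ∘ₗ e0.toLinearMap)
    (by
      refine ⟨?_, ?_, ?_⟩
      · intro z
        simp only [LinearMap.comp_apply, LinearEquiv.coe_coe, LinearEquiv.apply_symm_apply]
        exact (h1 _).1 ((h0 _).2 ⟨_, rfl⟩)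
      · intro z
        simp [hDD, hφ]
      · intro u v h
        simp only [LinearMap.comp_apply, LinearEquiv.coe_coe, LinearEquiv.apply_symm_apply,
          LinearMap.coprod_apply, LinearEquiv.map_eq_zero_iff] at h ⊢
        exact h)
    (by
      rintro m ⟨d, d', ψ⟩ ⟨hx1, hx2, hx3⟩
      simp only at hx1 hx2 hx3
      obtain ⟨χ, hχ⟩ := lift_free (-(ψ ∘ₗ d)) (D (m + 1)) (by
        intro z
        obtain ⟨y, hy⟩ := hx1 z
        exact ⟨-y, by simp [hy]⟩)
      refine ⟨(d', (es m).symm.toLinearMap ∘ₗ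
        (LinearMap.prod (LinearMap.coprod (D (m + 2)) χ) (d ∘ₗ LinearMap.snd R _ _)) ∘ₗ
          (es (m + 1)).toLinearMap, χ), ⟨rfl, ?_, ?_⟩, ?_⟩
      · intro z; simpa using hχ z
      · intro u v; simp
      · refine ⟨?_, ?_, ?_⟩
        · intro z
          simp only
          rw [← hex, hχ]
          simp [hx2]
        · intro z
          obtain ⟨⟨u, v⟩, rfl⟩ := (es (m + 1)).symm.surjective z
          have h3 : D (m + 1) (D (m + 2) u) = 0 := (hex _ _).2 ⟨u, rfl⟩
          have := hx3 (D (m + 2) u + χ v) v (by rw [map_add, hχ, h3]; simp)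
          simpa using this
        · intro u v h
          simp only at h
          simp [h, hx2])
  let d : ∀ m, (Fin (g (m + 1)) →₀ R) →ₗ[R] (Fin (g m) →₀ R) := fun m => (s m).1
  let ψ : ∀ m, (Fin (g m) →₀ R) →ₗ[R] (Fin (c (m + 1)) →₀ R) := fun m => (s m).2.2
  have hd : ∀ m, d (m + 1) = (s m).2.1 := fun m => (hsr m).1
  have hd0 : ∀ x, d 0 (e1.symm x) = e0.symm (D 0 x) := by
    intro x; simp only [d]; rw [hs0]; simp
  have hψ0 : ∀ x, ψ 0 x = φ (e0 x) := by
    intro x; simp only [ψ]; rw [hs0]; simp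
  have hd1 : ∀ u v, d 1 ((es 0).symm (u, v)) = e1.symm (D 1 u + ψ 0 v) := by
    intro u v; rw [hψ0, hd 0, hs0]; simp
  have hds : ∀ m u v, d (m + 2) ((es (m + 1)).symm (u, v)) =
      (es m).symm (D (m + 2) u + ψ (m + 1) v, d m v) := by
    intro m u v
    rw [hd (m + 1)]
    exact (hsr m).2.2 u v
  have hψ : ∀ m z, D (m + 1) (ψ (m + 1) z) = - ψ m (d m z) := fun m => (hsr m).2.1
  have hdd : ∀ m z, d m (d (m + 1) z) = 0 := fun m z => by
    rw [hd m]; exact (hsg m).2.1 z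
  clear_value d ψ
  have main : ∀ m z, d m z = 0 → ∃ w, d (m + 1) w = z := by
    intro m
    induction m using Nat.strong_induction_on with
    | _ m ih =>
    intro z hz
    match m, ih, z, hz with
    | 0, ih, z, hz =>
      obtain ⟨x, rfl⟩ := e1.symm.surjective z
      rw [hd0, LinearEquiv.map_eq_zero_iff] at hz
      obtain ⟨y, z, rfl⟩ := h2 x hz
      obtain ⟨y, rfl⟩ := e0.surjective y
      exact ⟨(es 0).symm (z, y), by rw [hd1, hψ0]⟩
    | 1, ih, z, hz =>
      obtain ⟨⟨u, v⟩, rfl⟩ := (es 0).symm.surjective z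
      rw [hd1, LinearEquiv.map_eq_zero_iff] at hz
      have h3 : aug (e0 v) = 0 := by
        rw [h1]
        refine ⟨-u, ?_⟩
        rw [map_neg, ← hψ0]
        exact neg_eq_of_add_eq_zero_right hz
      obtain ⟨y, hy⟩ := (h0 _).1 h3
      have hv : v = d 0 (e1.symm y) := by
        rw [hd0, hy, LinearEquiv.symm_apply_apply]
      subst hv
      rw [← neg_eq_iff_eq_neg.2 (hψ 0 _), ← sub_eq_add_neg, ← map_sub, hex] at hz
      obtain ⟨w, hw⟩ := hz
      refine ⟨(es 1).symm (w, e1.symm y), ?_⟩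
      rw [hds, hw]; simp
    | m + 2, ih, z, hz =>
      obtain ⟨⟨u, v⟩, rfl⟩ := (es (m + 1)).symm.surjective z
      rw [hds, LinearEquiv.map_eq_zero_iff, Prod.mk_eq_zero] at hz
      obtain ⟨y, rfl⟩ := ih m (by omega) v hz.2
      have hz := hz.1
      rw [← neg_eq_iff_eq_neg.2 (hψ (m + 1) _), ← sub_eq_add_neg, ← map_sub, hex] at hz
      obtain ⟨w, hw⟩ := hz
      refine ⟨(es (m + 2)).symm (w, y), ?_⟩
      rw [hds, hw]; simp
  refine ⟨⟨g, d, aug ∘ₗ e0.toLinearMap, haug.comp e0.surjective, ?_, ?_⟩, rfl⟩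
  · ext z
    simp only [LinearMap.mem_range, LinearMap.mem_ker, LinearMap.comp_apply,
      LinearEquiv.coe_coe, h0]
    constructor
    · rintro ⟨y, rfl⟩
      obtain ⟨y, rfl⟩ := e1.symm.surjective y
      exact ⟨y, by rw [hd0, LinearEquiv.apply_symm_apply]⟩
    · rintro ⟨y, hy⟩
      exact ⟨e1.symm y, by rw [hd0, hy, LinearEquiv.symm_apply_apply]⟩
  · intro i
    ext z
    simp only [LinearMap.mem_range, LinearMap.mem_ker]
    exact ⟨by rintro ⟨y, rfl⟩; exact hdd _ _, main i z⟩

/-- reduction of scalars -/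
noncomputable def red {Q R : Type*} [CommRing Q] [CommRing R] (f : Q →+* R) (n : ℕ) :
    (Fin n →₀ Q) →+ (Fin n →₀ R) := Finsupp.mapRange.addMonoidHom f.toAddMonoidHom

section shamash
variable {Q R : Type*} [CommRing Q] [CommRing R] (f : Q →+* R)
  {M : Type*} [AddCommGroup M] [Module R M] [Module Q M]

theorem red_apply (n : ℕ) (x : Fin n →₀ Q) (i) : red f n x i = f (x i) := rfl

theorem red_single (n : ℕ) (i : Fin n) (c : Q) :
    red f n (Finsupp.single i c) = f c • Finsupp.single i 1 := by
  simp [red]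

theorem red_smul (n : ℕ) (c : Q) (x : Fin n →₀ Q) : red f n (c • x) = f c • red f n x := by
  ext i; simp [red_apply]

theorem red_surj (hf : Function.Surjective f) (n : ℕ) : Function.Surjective (red f n) :=
  Finsupp.mapRange_surjective _ (map_zero f) hf

theorem red_zero (a : Q) (hk : RingHom.ker f = Ideal.span {a}) (n : ℕ) (x : Fin n →₀ Q) :
    red f n x = 0 ↔ ∃ y, a • y = x := by
  constructor
  · intro h
    have : ∀ i, ∃ y, a * y = x i := by
      intro i
      have h1 : x i ∈ RingHom.ker f := by
        rw [RingHom.mem_ker, ← red_apply, h]; rfl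
      rw [hk, Ideal.mem_span_singleton'] at h1
      obtain ⟨y, hy⟩ := h1
      exact ⟨y, by rw [mul_comm, hy]⟩
    choose y hy using this
    exact ⟨Finsupp.equivFunOnFinite.symm y, by ext i; simp [hy]⟩
  · rintro ⟨y, rfl⟩
    have : a ∈ RingHom.ker f := by rw [hk]; exact Ideal.mem_span_singleton_self a
    rw [red_smul, RingHom.mem_ker.1 this, zero_smul]

theorem exists_red {n m : ℕ} (L : (Fin n →₀ Q) →ₗ[Q] (Fin m →₀ Q)) :
    ∃ L' : (Fin n →₀ R) →ₗ[R] (Fin m →₀ R), ∀ x, L' (red f n x) = red f m (L x) := by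
  refine ⟨Finsupp.linearCombination R (fun i => red f m (L (Finsupp.single i 1))), fun x => ?_⟩
  induction x using Finsupp.induction_linear with
  | zero => simp
  | add x y hx hy => simp [hx, hy]
  | single i c =>
    rw [red_single, show Finsupp.single i c = c • Finsupp.single i (1 : Q) by simp, map_smul,
      map_smul, red_smul]
    simp

theorem exists_red_aug (hc : ∀ (c : Q) (x : M), c • x = f c • x) {n : ℕ}
    (L : (Fin n →₀ Q) →ₗ[Q] M) :
    ∃ L' : (Fin n →₀ R) →ₗ[R] M, ∀ x, L' (red f n x) = L x := by
  refine ⟨Finsupp.linearCombination R (fun i => L (Finsupp.single i 1)), fun x => ?_⟩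
  induction x using Finsupp.induction_linear with
  | zero => simp
  | add x y hx hy => simp [hx, hy]
  | single i c =>
    rw [red_single, show Finsupp.single i c = c • Finsupp.single i (1 : Q) by simp, map_smul,
      map_smul, hc]
    simp

theorem shamash_one (hc : ∀ (c : Q) (x : M), c • x = f c • x) (hf : Function.Surjective f)
    (a : Q) (hk : RingHom.ker f = Ideal.span {a}) (ha : IsSMulRegular Q a)
    (F : FreeResolution Q M) : ∃ G : FreeResolution R M, G.rk = sh F.rk := by
  have hfa : f a = 0 := by
    rw [← RingHom.mem_ker, hk]; exact Ideal.mem_span_singleton_self a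
  have hreg : ∀ {n : ℕ} (x y : Fin n →₀ Q), a • x = a • y → x = y := by
    intro n x y h
    ext i
    exact ha (DFunLike.congr_fun h i)
  choose D hD using fun m => exists_red f (F.d m)
  obtain ⟨aug, haug⟩ := exists_red_aug f hc F.aug
  obtain ⟨h, hh⟩ := lift_free (a • LinearMap.id) (F.d 0) (by
    intro x
    rw [LinearMap.mem_range, ← d0_mem]
    simp [hc, hfa])
  replace hh : ∀ x, F.d 0 (h x) = a • x := hh
  obtain ⟨φ, hφ⟩ := exists_red f h
  have hz := fun n => red_zero f a hk n
  have hsurj := fun n => red_surj f hf n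
  have heq : ∀ {n} (x y : Fin n →₀ Q), red f n x = red f n y → ∃ w, x = y + a • w := by
    intro n x y hxy
    rw [← sub_eq_zero, ← map_sub, hz] at hxy
    obtain ⟨w, hw⟩ := hxy
    exact ⟨w, by rw [hw]; abel⟩
  have hra : ∀ {n} (x : Fin n →₀ Q), red f n (a • x) = 0 := fun x => (hz _ _).2 ⟨x, rfl⟩
  refine splice F.rk D aug ?_ ?_ ?_ ?_ φ ?_ ?_ ?_ (sh F.rk) rfl rfl (fun _ => rfl)
  · intro x
    obtain ⟨y, rfl⟩ := F.aug_surjective x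
    exact ⟨_, haug y⟩
  · intro x
    obtain ⟨x, rfl⟩ := hsurj _ x
    rw [haug, d0_mem]
    constructor
    · rintro ⟨y, rfl⟩
      exact ⟨_, hD _ y⟩
    · rintro ⟨y, hy⟩
      obtain ⟨y, rfl⟩ := hsurj _ y
      rw [hD] at hy
      obtain ⟨w, hw⟩ := heq _ _ hy.symm
      rw [← d0_mem, hw]
      simp [aug_d, hc, hfa]
  · intro m x
    obtain ⟨x, rfl⟩ := hsurj _ x
    constructor
    · intro hx
      rw [hD, hz] at hx
      obtain ⟨y, hy⟩ := hx
      have h1 : F.d m y = 0 := by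
        apply hreg
        rw [← map_smul, hy, dd, smul_zero]
      obtain ⟨w, rfl⟩ := (ds_mem _ _ _).1 h1
      rw [← map_smul, ← sub_eq_zero, ← map_sub, ds_mem] at hy
      obtain ⟨z, hz'⟩ := hy
      refine ⟨red f _ (-z), ?_⟩
      rw [hD, map_neg, hz', neg_sub, map_sub, hra, sub_zero]
    · rintro ⟨y, hy⟩
      obtain ⟨y, rfl⟩ := hsurj _ y
      rw [← hy, hD, hD, dd, map_zero]
  · intro x
    obtain ⟨x, rfl⟩ := hsurj _ x
    rw [hD, hD, dd, map_zero]
  · intro x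
    obtain ⟨x, rfl⟩ := hsurj _ x
    rw [hφ, hD, hh, hra]
  · intro x
    obtain ⟨x, rfl⟩ := hsurj _ x
    rw [haug, d0_mem]
    constructor
    · rintro ⟨w, rfl⟩
      have h1 : F.d 0 (h (F.d 0 w) - a • w) = 0 := by
        rw [map_sub, hh, map_smul, sub_self]
      obtain ⟨z, hz'⟩ := (ds_mem _ _ _).1 h1
      refine ⟨red f _ z, ?_⟩
      rw [hD, hφ, hz', map_sub, hra, sub_zero]
    · rintro ⟨z, hz'⟩
      obtain ⟨z, rfl⟩ := hsurj _ z
      rw [hD, hφ] at hz'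
      obtain ⟨w, hw⟩ := heq _ _ hz'.symm
      refine ⟨w, hreg _ _ ?_⟩
      rw [← hh x, hw, map_add, dd, map_smul]
      exact (zero_add _).symm
  · intro x hx
    obtain ⟨x, rfl⟩ := hsurj _ x
    rw [hD, hz] at hx
    obtain ⟨y, hy⟩ := hx
    rw [← hh, ← sub_eq_zero, ← map_sub, ds_mem] at hy
    obtain ⟨z, hz'⟩ := hy
    refine ⟨red f _ y, red f _ (-z), ?_⟩
    rw [hD, hφ, map_neg, hz', ← map_add]
    congr 1; abel

end shamash

theorem base_change_equiv {Q R : Type*} [CommRing Q] [CommRing R] (f : Q →+* R)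
    {M : Type*} [AddCommGroup M] [Module R M] [Module Q M]
    (hc : ∀ (c : Q) (x : M), c • x = f c • x) (hf : Function.Bijective f)
    (F : FreeResolution Q M) : ∃ G : FreeResolution R M, G.rk = F.rk := by
  choose D hD using fun m => exists_red f (F.d m)
  obtain ⟨aug, haug⟩ := exists_red_aug f hc F.aug
  have hsurj := fun n => red_surj f hf.2 n
  have hinj : ∀ n, Function.Injective (red f n) := fun n =>
    Finsupp.mapRange_injective _ (map_zero f) hf.1
  refine ⟨⟨F.rk, D, aug, ?_, ?_, ?_⟩, rfl⟩
  · intro x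
    obtain ⟨y, rfl⟩ := F.aug_surjective x
    exact ⟨_, haug y⟩
  · ext x
    obtain ⟨x, rfl⟩ := hsurj _ x
    rw [LinearMap.mem_ker, LinearMap.mem_range, haug, d0_mem]
    constructor
    · rintro ⟨y, hy⟩
      obtain ⟨y, rfl⟩ := hsurj _ y
      exact ⟨y, hinj _ (by rw [← hD, hy])⟩
    · rintro ⟨y, rfl⟩
      exact ⟨_, hD _ y⟩
  · intro i
    ext x
    obtain ⟨x, rfl⟩ := hsurj _ x
    rw [LinearMap.mem_ker, LinearMap.mem_range, hD, map_eq_zero_iff _ (hinj _), ds_mem]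
    constructor
    · rintro ⟨y, hy⟩
      obtain ⟨y, rfl⟩ := hsurj _ y
      exact ⟨y, hinj _ (by rw [← hD, hy])⟩
    · rintro ⟨y, rfl⟩
      exact ⟨_, hD _ y⟩

theorem transfer {R : Type*} [CommRing R] {M M' : Type*} [AddCommGroup M] [Module R M]
    [AddCommGroup M'] [Module R M'] (e : M ≃ₗ[R] M') (F : FreeResolution R M) :
    ∃ G : FreeResolution R M', G.rk = F.rk := by
  refine ⟨⟨F.rk, F.d, e.toLinearMap ∘ₗ F.aug, e.surjective.comp F.aug_surjective, ?_,
    F.exact_succ⟩, rfl⟩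
  rw [F.exact_zero]
  ext x
  simp

theorem shamash_list {R : Type*} [CommRing R] {M : Type*} [AddCommGroup M] [Module R M] :
    ∀ (r : ℕ) {Q : Type*} [CommRing Q] (f : Q →+* R) [Module Q M]
    (_ : ∀ (c : Q) (x : M), c • x = f c • x) (_ : Function.Surjective f)
    (as : List Q) (_ : as.length = r) (_ : RingHom.ker f = Ideal.ofList as)
    (_ : RingTheory.Sequence.IsWeaklyRegular Q as)
    (F : FreeResolution Q M), ∃ G : FreeResolution R M, G.rk = sh^[r] F.rk := by
  intro r
  induction r with
  | zero =>
    intro Q _ f _ hc hf as hr hk _ F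
    obtain rfl := List.length_eq_zero_iff.1 hr
    rw [Ideal.ofList_nil] at hk
    exact base_change_equiv f hc ⟨(RingHom.injective_iff_ker_eq_bot f).2 hk, hf⟩ F
  | succ r ih =>
    intro Q _ f _ hc hf as hr hk hreg F
    obtain _ | ⟨a, as⟩ := as
    · simp at hr
    rw [RingTheory.Sequence.isWeaklyRegular_cons_iff] at hreg
    obtain ⟨ha, hreg⟩ := hreg
    have hle : Ideal.span {a} ≤ RingHom.ker f := by
      rw [hk, Ideal.ofList_cons]; exact le_sup_left
    let f' : (Q ⧸ Ideal.span {a}) →+* R := Ideal.Quotient.lift (Ideal.span {a}) f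
      (fun x hx => hle hx)
    have hf' : ∀ x, f' (Ideal.Quotient.mk _ x) = f x := fun x => rfl
    let _ : Module (Q ⧸ Ideal.span {a}) M := Module.compHom M f'
    have hc' : ∀ (c : Q ⧸ Ideal.span {a}) (x : M), c • x = f' c • x := fun _ _ => rfl
    obtain ⟨F', hF'⟩ := shamash_one (R := Q ⧸ Ideal.span {a}) (M := M)
      (Ideal.Quotient.mk (Ideal.span {a}))
      (fun c x => by rw [hc', hf', hc]) Ideal.Quotient.mk_surjective a Ideal.mk_ker ha F
    rw [Function.iterate_succ_apply, ← hF']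
    refine ih f' hc' (Ideal.Quotient.lift_surjective_of_surjective _ _ hf)
      (as.map (Ideal.Quotient.mk _)) (by simpa using hr) ?_ ?_ F'
    · rw [← Ideal.map_ofList]
      ext x
      obtain ⟨x, rfl⟩ := Ideal.Quotient.mk_surjective x
      rw [RingHom.mem_ker, hf', ← RingHom.mem_ker, hk, Ideal.ofList_cons,
        ← Ideal.mem_comap, Ideal.comap_map_of_surjective _ Ideal.Quotient.mk_surjective,
        ← RingHom.ker_eq_comap_bot, Ideal.mk_ker, sup_comm]
    · have e : QuotSMulTop a Q ≃ₗ[Q] (Q ⧸ Ideal.span {a}) :=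
        Submodule.quotEquivOfEq _ _ (by
          rw [← Submodule.ideal_span_singleton_smul]; simp)
      rw [e.isWeaklyRegular_congr] at hreg
      exact (RingTheory.Sequence.isWeaklyRegular_map_algebraMap_iff
        (Q ⧸ Ideal.span {a}) (Q ⧸ Ideal.span {a}) as).2 hreg

/-- combinatorics -/
def U (r : ℕ) (f : ℕ → ℕ) (m : ℕ) : ℕ :=
  ∑ j ∈ Finset.range (m / 2 + 1), f (m - 2 * j) * (r + j).choose r

theorem U_zero (f : ℕ → ℕ) : ∀ m, sh f m = U 0 f m
  | 0 => by simp [U, sh]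
  | 1 => by simp [U, sh]
  | m + 2 => by
    rw [sh, U_zero f m, U, U, show (m + 2) / 2 + 1 = (m / 2 + 1) + 1 by omega,
      Finset.sum_range_succ' _ (m / 2 + 1)]
    simp only [Nat.choose_zero_right, mul_one, mul_zero, Nat.sub_zero]
    rw [add_comm]
    congr 1
    refine Finset.sum_congr rfl fun j _ => ?_
    congr 1; omega

theorem U_succ (r : ℕ) (f : ℕ → ℕ) : ∀ m, sh (U r f) m = U (r + 1) f m
  | 0 => by simp [U, sh]
  | 1 => by simp [U, sh]
  | m + 2 => by
    rw [sh, U_succ r f m, U, U, U, show (m + 2) / 2 + 1 = (m / 2 + 1) + 1 by omega,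
      Finset.sum_range_succ' _ (m / 2 + 1), Finset.sum_range_succ' _ (m / 2 + 1)]
    simp only [mul_zero, Nat.sub_zero, add_zero, Nat.choose_self, mul_one]
    rw [add_right_comm, ← Finset.sum_add_distrib]
    congr 1
    refine Finset.sum_congr rfl fun j _ => ?_
    rw [show m + 2 - 2 * (j + 1) = m - 2 * j by omega, ← mul_add,
      show r + 1 + (j + 1) = (r + (j + 1)) + 1 by omega, Nat.choose_succ_succ,
      show r + 1 + j = r + (j + 1) by omega]

theorem sh_iter (r : ℕ) (f : ℕ → ℕ) : sh^[r + 1] f = U r f := by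
  induction r with
  | zero => funext m; exact U_zero f m
  | succ r ih =>
    rw [Function.iterate_succ_apply', ih]
    funext m; exact U_succ r f m

def pv (q s m : ℕ) : ℕ := q.choose m - (if s ≤ m then (q - s).choose (m - s) else 0)

theorem choose_sub_le (q s m : ℕ) (hq : s ≤ q) (hm : s ≤ m) :
    (q - s).choose (m - s) ≤ q.choose m := by
  obtain ⟨q, rfl⟩ := Nat.exists_eq_add_of_le hq
  obtain ⟨m, rfl⟩ := Nat.exists_eq_add_of_le hm
  simp only [Nat.add_sub_cancel_left]
  clear hq hm
  induction s with
  | zero => simp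
  | succ s ih =>
    rw [show s + 1 + q = (s + q) + 1 by omega, show s + 1 + m = (s + m) + 1 by omega,
      Nat.choose_succ_succ]
    omega

theorem pv_zero (q s : ℕ) : pv (q + 1) (s + 1) 0 = q.choose 0 := by simp [pv]

theorem pv_succ (q s m : ℕ) (h : s ≤ q) :
    pv (q + 1) (s + 1) (m + 1) = q.choose (m + 1) + pv q s m := by
  simp only [pv, Nat.add_le_add_iff_right, Nat.add_sub_add_right, Nat.choose_succ_succ, Nat.succ_eq_add_one]
  split_ifs with h1
  · have := choose_sub_le q s m h h1
    omega
  · omega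

section mono
variable (k : Type*) [Field k] {n : ℕ}

noncomputable def mI (L : List (Fin n →₀ ℕ)) : Ideal (MvPolynomial (Fin n) k) :=
  Ideal.span ((fun s => monomial s (1 : k)) '' {e | e ∈ L})

theorem mem_mI (L : List (Fin n →₀ ℕ)) (x : MvPolynomial (Fin n) k) :
    x ∈ mI k L ↔ ∀ xi ∈ x.support, ∃ si ∈ L, si ≤ xi := mem_ideal_span_monomial_image

theorem colon (e : Fin n →₀ ℕ) (L : List (Fin n →₀ ℕ)) (x : MvPolynomial (Fin n) k) :
    monomial e (1 : k) * x ∈ mI k L ↔ x ∈ mI k (L.map (· - e)) := by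
  rw [mem_mI, mem_mI]
  constructor
  · intro h u hu
    obtain ⟨s, hs, hsu⟩ := h (e + u) (by
      rw [mem_support_iff, coeff_monomial_mul]; simpa using hu)
    exact ⟨s - e, List.mem_map_of_mem hs, tsub_le_iff_left.2 hsu⟩
  · intro h u hu
    rw [mem_support_iff, coeff_monomial_mul'] at hu
    split_ifs at hu with heu
    · obtain ⟨t, ht, hsu⟩ := h (u - e) (by rw [mem_support_iff]; simpa using hu)
      obtain ⟨s, hs, rfl⟩ := List.mem_map.1 ht
      refine ⟨s, hs, ?_⟩
      have := tsub_le_iff_right.1 hsu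
      rwa [tsub_add_cancel_of_le heu] at this
    · exact absurd rfl hu

theorem cone_mono (e : Fin n →₀ ℕ) (L : List (Fin n →₀ ℕ))
    (A : FreeResolution (MvPolynomial (Fin n) k) (MvPolynomial (Fin n) k ⧸ mI k (L.map (· - e))))
    (B : FreeResolution (MvPolynomial (Fin n) k) (MvPolynomial (Fin n) k ⧸ mI k L))
    (c : ℕ → ℕ) (hc0 : c 0 = B.rk 0) (hcs : ∀ m, c (m + 1) = B.rk (m + 1) + A.rk m) :
    ∃ C : FreeResolution (MvPolynomial (Fin n) k) (MvPolynomial (Fin n) k ⧸ mI k (e :: L)), C.rk = c := by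
  have hle : mI k L ≤ mI k (e :: L) :=
    Ideal.span_mono (Set.image_mono fun x hx => List.mem_cons_of_mem _ hx)
  have hco : mI k (L.map (· - e)) ≤ Submodule.comap
      (LinearMap.mulLeft (MvPolynomial (Fin n) k) (monomial e (1 : k))) (mI k L) :=
    fun x hx => (colon k e L x).2 hx
  refine cone A B
    (Submodule.mapQ (mI k (L.map (· - e))) (mI k L)
      (LinearMap.mulLeft (MvPolynomial (Fin n) k) (monomial e (1 : k))) hco)
    (Submodule.factor hle) ?_ (Submodule.factor_surjective hle) ?_ c hc0 hcs
  · rw [← LinearMap.ker_eq_bot, LinearMap.ker_eq_bot']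
    intro x hx
    obtain ⟨x, rfl⟩ := Submodule.Quotient.mk_surjective _ x
    rw [Submodule.mapQ_apply, Submodule.Quotient.mk_eq_zero] at hx
    rw [Submodule.Quotient.mk_eq_zero]
    exact (colon k e L x).1 hx
  · intro x
    obtain ⟨x, rfl⟩ := Submodule.Quotient.mk_surjective _ x
    have h1 : Submodule.factor hle (Submodule.Quotient.mk x) = Submodule.Quotient.mk x := rfl
    rw [h1, Submodule.Quotient.mk_eq_zero]
    have h2 : mI k (e :: L) = Ideal.span (insert (monomial e (1 : k))
        ((fun s => monomial s (1 : k)) '' {e | e ∈ L})) := by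
      rw [← Set.image_insert_eq (f := fun s => monomial s (1 : k)), mI]
      congr 2
      ext y; simp
    rw [h2, Ideal.mem_span_insert]
    constructor
    · rintro ⟨a, z, hz, rfl⟩
      refine ⟨Submodule.Quotient.mk a, ?_⟩
      rw [Submodule.mapQ_apply, LinearMap.mulLeft_apply, Submodule.Quotient.eq]
      have : monomial e (1 : k) * a - (a * monomial e (1 : k) + z) = -z := by ring
      rw [this]
      exact neg_mem hz
    · rintro ⟨y, hy⟩
      obtain ⟨y, rfl⟩ := Submodule.Quotient.mk_surjective _ y
      rw [Submodule.mapQ_apply, LinearMap.mulLeft_apply, Submodule.Quotient.eq] at hy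
      exact ⟨y, _, neg_mem hy, by ring⟩

theorem taylor (L : List (Fin n →₀ ℕ)) :
    ∃ C : FreeResolution (MvPolynomial (Fin n) k) (MvPolynomial (Fin n) k ⧸ mI k L),
      C.rk = fun m => L.length.choose m := by
  generalize hN : L.length = N
  induction N generalizing L with
  | zero =>
    obtain rfl := List.length_eq_zero_iff.1 hN
    have hbot : mI k ([] : List (Fin n →₀ ℕ)) = ⊥ := by simp [mI]
    obtain ⟨e0⟩ := spl0 (MvPolynomial (Fin n) k) 1 (Nat.choose 0 0) (by simp)
    let e1 : (Fin 1 →₀ MvPolynomial (Fin n) k) ≃ₗ[MvPolynomial (Fin n) k]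
      MvPolynomial (Fin n) k := Finsupp.LinearEquiv.finsuppUnique _ _ _
    let e2 := (Submodule.quotEquivOfEqBot _ hbot).symm
    let e := e0.trans (e1.trans e2)
    have hsub : ∀ m, Subsingleton (Fin (Nat.choose 0 (m + 1)) →₀ MvPolynomial (Fin n) k) := by
      intro m
      rw [Nat.choose_zero_succ]
      infer_instance
    refine ⟨⟨fun m => Nat.choose 0 m, fun _ => 0, e.toLinearMap, e.surjective, ?_, ?_⟩, rfl⟩
    · rw [LinearMap.range_zero, LinearEquiv.ker]
    · intro i
      have := hsub i
      exact Subsingleton.elim _ _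
  | succ N ih =>
    obtain _ | ⟨e, L⟩ := L
    · simp at hN
    have hL : L.length = N := by simpa using hN
    obtain ⟨A, hA⟩ := ih (L.map (· - e)) (by simpa using hL)
    obtain ⟨B, hB⟩ := ih L hL
    exact cone_mono k e L A B _ (by simp [hB]) (by
      intro m; rw [hA, hB, Nat.choose_succ_succ, add_comm])

theorem pivot (S L : List (Fin n →₀ ℕ)) (j : Fin n →₀ ℕ) (hj : j ∈ L)
    (h : ∀ x, j x = 0 ∨ ∃ e ∈ S, j x ≤ e x) :
    ∃ C : FreeResolution (MvPolynomial (Fin n) k) (MvPolynomial (Fin n) k ⧸ mI k (S ++ L)),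
      C.rk = fun m => pv (S.length + L.length) S.length m := by
  generalize hN : S.length = N
  induction N generalizing S L j with
  | zero =>
    obtain rfl := List.length_eq_zero_iff.1 hN
    have hj0 : j = 0 := by ext x; simpa using h x
    subst hj0
    have htop : mI k ([] ++ L) = ⊤ := by
      rw [Ideal.eq_top_iff_one]
      exact Ideal.subset_span ⟨0, hj, by simp⟩
    have : Subsingleton (MvPolynomial (Fin n) k ⧸ mI k ([] ++ L)) := by
      rw [htop]; infer_instance
    have hpv : (fun m => pv (0 + L.length) 0 m) = fun _ => 0 := by
      funext m; simp [pv]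
    rw [hpv]
    refine ⟨⟨fun _ => 0, fun _ => 0, 0, Function.surjective_to_subsingleton _, ?_, ?_⟩, rfl⟩
    · exact Subsingleton.elim _ _
    · intro i; exact Subsingleton.elim _ _
  | succ N ih =>
    obtain _ | ⟨e, S⟩ := S
    · simp at hN
    have hS : S.length = N := by simpa using hN
    have hA0 := ih (S.map (· - e)) (L.map (· - e)) (j - e)
      (List.mem_map_of_mem hj) (by
        intro x
        rcases h x with h0 | ⟨s, hs, hjs⟩
        · left; simp [h0]
        · rcases List.mem_cons.1 hs with rfl | hs
          · left; simp [hjs]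
          · right
            refine ⟨s - e, List.mem_map_of_mem hs, ?_⟩
            simp only [Finsupp.tsub_apply]
            omega) (by simpa using hS)
    rw [← List.map_append, List.length_map] at hA0
    obtain ⟨A, hA⟩ := hA0
    obtain ⟨B, hB⟩ := taylor k (S ++ L)
    have e1 : N + 1 + L.length = (N + L.length) + 1 := by omega
    refine cone_mono k e (S ++ L) A B _ ?_ ?_
    · rw [hB]
      simp only [e1, pv_zero, List.length_append, hS]
    · intro m
      rw [hA, hB]
      simp only [e1, List.length_append, hS]
      exact pv_succ _ _ _ (by omega)

end mono

theorem pv_main {k : Type*} [Field k] {n q : ℕ} (D : Fin q → (Fin n →₀ ℕ))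
    (hfin : (scarfSet k n q D).Nonempty) :
    ∃ C : FreeResolution (MvPolynomial (Fin n) k) (MvPolynomial (Fin n) k ⧸ monIdeal k n q D),
      C.rk = fun m => pv q (sInf (scarfSet k n q D)) m := by
  obtain ⟨S, T, hST, hS, hl⟩ := Nat.sInf_mem hfin
  have hsup : S.sup D = T.sup D := by
    unfold lcmMono at hl
    exact (monomial_left_injective (one_ne_zero)) hl
  have hT : sInf (scarfSet k n q D) ≤ T.card :=
    Nat.sInf_le ⟨T, S, hST.symm, rfl, hl.symm⟩
  obtain ⟨j, hjT, hjS⟩ : ∃ j ∈ T, j ∉ S := by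
    by_contra hcon
    push Not at hcon
    exact hST (Finset.eq_of_subset_of_card_le hcon (by omega)).symm
  have hj : D j ≤ S.sup D := by rw [hsup]; exact Finset.le_sup hjT
  have hlen : (S.toList.map D).length = sInf (scarfSet k n q D) := by simp [hS]
  have hlen2 : (S.toList.map D).length + (Sᶜ.toList.map D).length = q := by
    simp only [List.length_map, Finset.length_toList]
    rw [Finset.card_add_card_compl, Fintype.card_fin]
  have hI : mI k (S.toList.map D ++ Sᶜ.toList.map D) = monIdeal k n q D := by
    unfold mI monIdeal
    congr 1
    ext y
    simp only [List.mem_append, List.mem_map, Finset.mem_toList, Finset.mem_compl, Set.mem_image,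
      Set.mem_ofPred_eq, Set.mem_range]
    constructor
    · rintro ⟨e, ⟨i, -, rfl⟩ | ⟨i, -, rfl⟩, rfl⟩
      · exact ⟨i, rfl⟩
      · exact ⟨i, rfl⟩
    · rintro ⟨i, rfl⟩
      refine ⟨D i, ?_, rfl⟩
      by_cases hi : i ∈ S
      · exact Or.inl ⟨i, hi, rfl⟩
      · exact Or.inr ⟨i, hi, rfl⟩
  have key : ∀ (T : Finset (Fin q)) (x : Fin n), (T.sup D) x = 0 ∨ ∃ e ∈ T, (T.sup D) x ≤ D e x := by
    intro T x
    induction T using Finset.induction_on with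
    | empty => left; rw [Finset.sup_empty]; rfl
    | insert b T hb ih =>
      rw [Finset.sup_insert, Finsupp.sup_apply]
      rcases le_total (D b x) (T.sup D x) with h | h
      · rw [sup_eq_right.2 h]
        rcases ih with ih | ⟨e, he, hle⟩
        · exact Or.inl ih
        · exact Or.inr ⟨e, Finset.mem_insert_of_mem he, hle⟩
      · rw [sup_eq_left.2 h]
        exact Or.inr ⟨b, Finset.mem_insert_self _ _, le_rfl⟩
  have := pivot k (S.toList.map D) (Sᶜ.toList.map D) (D j)
    (List.mem_map_of_mem (by simpa using hjS)) (by
      intro x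
      have hx := hj x
      rcases key S x with h | ⟨e, he, hle⟩
      · left; omega
      · right
        exact ⟨D e, List.mem_map_of_mem (by simpa using he), hx.trans hle⟩)
  rwa [hI, hlen2, hlen] at this

theorem main_res {k : Type*} [Field k] {n q : ℕ} (D : Fin q → (Fin n →₀ ℕ))
    (hfin : (scarfSet k n q D).Nonempty)
    (r : ℕ) (a : Fin (r + 1) → MvPolynomial (Fin n) k)
    (haI : ∀ s, a s ∈ monIdeal k n q D)
    (hreg : RingTheory.Sequence.IsRegular (MvPolynomial (Fin n) k) (List.ofFn a)) :
    ∃ G : FreeResolution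
        (MvPolynomial (Fin n) k ⧸ Ideal.span (Set.range a))
        ((MvPolynomial (Fin n) k ⧸ Ideal.span (Set.range a)) ⧸
          (monIdeal k n q D).map (Ideal.Quotient.mk (Ideal.span (Set.range a)))),
      G.rk = U r (pv q (sInf (scarfSet k n q D))) := by
  obtain ⟨C, hC⟩ := pv_main D hfin
  have hJ : Ideal.span (Set.range a) ≤ monIdeal k n q D := by
    rw [Ideal.span_le]
    rintro _ ⟨i, rfl⟩
    exact haI i
  obtain ⟨C', hC'⟩ := transfer
    (DoubleQuot.quotQuotEquivQuotOfLEₐ (MvPolynomial (Fin n) k) hJ).symm.toLinearEquiv C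
  obtain ⟨G, hG⟩ := shamash_list (r + 1) (Ideal.Quotient.mk (Ideal.span (Set.range a)))
    (fun c x => by
      rw [← Ideal.Quotient.algebraMap_eq, algebraMap_smul])
    Ideal.Quotient.mk_surjective (List.ofFn a) (by simp)
    (by
      rw [Ideal.mk_ker, Ideal.ofList]
      congr 1
      ext x
      exact List.mem_ofFn.symm) hreg.toIsWeaklyRegular C'
  refine ⟨G, ?_⟩
  rw [hG, sh_iter, hC', hC]

end ES

/-- **Betti number bounds over complete intersections (Eisenbud–Shamash applied to
pivot resolutions).**
Let `a_1,…,a_r ∈ I` be a regular sequence in `Q`, `R = Q/(a_1,…,a_r)`, and suppose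
`s := scarf(I) < ∞`.  Then `R/I` admits a free resolution `G` over `R` with
`rank G_m = Σ_{j=0}^{⌊m/2⌋} (binom(q, m−2j) − binom(q−s, m−2j−s))·binom(r+j−1, r−1)`;
consequently, every minimal free resolution `F` of `R/I` over `R` satisfies
`rank F_{2i} ≤ Σ_{j=0}^{i} (binom(q,2j) − binom(q−s,2j−s))·binom(r+i−j−1, r−1)` and
`rank F_{2i+1} ≤ Σ_{j=0}^{i} (binom(q,2j+1) − binom(q−s,2j+1−s))·binom(r+i−j−1, r−1)`. -/
theorem eisenbudShamash_pivot_betti_bounds {k : Type*} [Field k] {n q : ℕ}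
    (D : Fin q → (Fin n →₀ ℕ))
    (hne : ∀ i : Fin q, D i ≠ 0)
    (hmin : ∀ i j : Fin q, i ≠ j → ¬ lcmMono k n q D {i} ∣ lcmMono k n q D {j})
    (hfin : (scarfSet k n q D).Nonempty)
    (r : ℕ) (hr : 0 < r) (a : Fin r → MvPolynomial (Fin n) k)
    (haI : ∀ s : Fin r, a s ∈ monIdeal k n q D)
    (hreg : RingTheory.Sequence.IsRegular (MvPolynomial (Fin n) k) (List.ofFn a)) :
    (∃ G : FreeResolution
        (MvPolynomial (Fin n) k ⧸ Ideal.span (Set.range a))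
        ((MvPolynomial (Fin n) k ⧸ Ideal.span (Set.range a)) ⧸
          (monIdeal k n q D).map (Ideal.Quotient.mk (Ideal.span (Set.range a)))),
      ∀ m : ℕ, G.rk m = ∑ j ∈ Finset.range (m / 2 + 1),
        (q.choose (m - 2 * j) -
            (if sInf (scarfSet k n q D) ≤ m - 2 * j then
              (q - sInf (scarfSet k n q D)).choose
                (m - 2 * j - sInf (scarfSet k n q D))
            else 0)) *
          (r + j - 1).choose (r - 1)) ∧
    (∀ F : MinimalFreeResolution
        (MvPolynomial (Fin n) k ⧸ Ideal.span (Set.range a))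
        ((Ideal.span (Set.range (X : Fin n → MvPolynomial (Fin n) k))).map
          (Ideal.Quotient.mk (Ideal.span (Set.range a))))
        ((MvPolynomial (Fin n) k ⧸ Ideal.span (Set.range a)) ⧸
          (monIdeal k n q D).map (Ideal.Quotient.mk (Ideal.span (Set.range a)))),
      ∀ i : ℕ,
        F.rk (2 * i) ≤ ∑ j ∈ Finset.range (i + 1),
          (q.choose (2 * j) -
              (if sInf (scarfSet k n q D) ≤ 2 * j then
                (q - sInf (scarfSet k n q D)).choose (2 * j - sInf (scarfSet k n q D))
              else 0)) *
            (r + i - j - 1).choose (r - 1) ∧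
        F.rk (2 * i + 1) ≤ ∑ j ∈ Finset.range (i + 1),
          (q.choose (2 * j + 1) -
              (if sInf (scarfSet k n q D) ≤ 2 * j + 1 then
                (q - sInf (scarfSet k n q D)).choose
                  (2 * j + 1 - sInf (scarfSet k n q D))
              else 0)) *
            (r + i - j - 1).choose (r - 1)) := by
  obtain ⟨r, rfl⟩ : ∃ t, r = t + 1 := ⟨r - 1, by omega⟩
  obtain ⟨G, hG⟩ := ES.main_res D hfin r a haI hreg
  have hrk : ∀ m, G.rk m = ∑ j ∈ Finset.range (m / 2 + 1),
      ES.pv q (sInf (scarfSet k n q D)) (m - 2 * j) * (r + j).choose r := by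
    intro m; rw [hG]; rfl
  refine ⟨⟨G, ?_⟩, ?_⟩
  · intro m
    rw [hrk]
    refine Finset.sum_congr rfl fun j _ => ?_
    rw [show r + 1 + j - 1 = r + j by omega, show r + 1 - 1 = r by omega]
    rfl
  · intro F i
    have hc : ∀ x ∈ Ideal.span (Set.range a), constantCoeff (σ := Fin n) (R := k) x = 0 := by
      intro x hx
      have hle : Ideal.span (Set.range a) ≤ RingHom.ker (constantCoeff (σ := Fin n) (R := k)) := by
        have h1 : monIdeal k n q D ≤ RingHom.ker (constantCoeff (σ := Fin n) (R := k)) := by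
          unfold monIdeal
          rw [Ideal.span_le]
          rintro _ ⟨i, rfl⟩
          simp only [SetLike.mem_coe, RingHom.mem_ker, constantCoeff_monomial]
          exact if_neg (hne i)
        rw [Ideal.span_le]
        rintro _ ⟨i, rfl⟩
        exact h1 (haI i)
      exact hle hx
    have hle := ES.minimal_le (Ideal.Quotient.lift (Ideal.span (Set.range a))
      (constantCoeff (σ := Fin n) (R := k)) hc) _ (by
        intro x hx
        rw [← RingHom.mem_ker]
        refine (Ideal.map_le_iff_le_comap.2 ?_ :
          (Ideal.span (Set.range (X : Fin n → MvPolynomial (Fin n) k))).map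
            (Ideal.Quotient.mk (Ideal.span (Set.range a))) ≤ _) hx
        rw [Ideal.span_le]
        rintro _ ⟨i, rfl⟩
        simp [RingHom.mem_ker]) F G
    constructor
    · refine (hle _).trans (le_of_eq ?_)
      rw [hrk, show 2 * i / 2 + 1 = i + 1 by omega, ← Finset.sum_range_reflect]
      refine Finset.sum_congr rfl fun j hj => ?_
      have hj := Finset.mem_range.1 hj
      rw [show r + 1 + i - j - 1 = r + (i + 1 - 1 - j) by omega,
        show 2 * i - 2 * (i + 1 - 1 - j) = 2 * j by omega, show r + 1 - 1 = r by omega]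
      rfl
    · refine (hle _).trans (le_of_eq ?_)
      rw [hrk, show (2 * i + 1) / 2 + 1 = i + 1 by omega, ← Finset.sum_range_reflect]
      refine Finset.sum_congr rfl fun j hj => ?_
      have hj := Finset.mem_range.1 hj
      rw [show r + 1 + i - j - 1 = r + (i + 1 - 1 - j) by omega,
        show 2 * i + 1 - 2 * (i + 1 - 1 - j) = 2 * j + 1 by omega,
        show r + 1 - 1 = r by omega]
      rfl
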